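/- arXiv:1911.11724 — 3 statements merged into one kernel-verified Lean document; each statement's English description precedes it below -/
import Mathlib

section
/- Fix τ in the upper half-plane ℍ. Suppose F : ℂ → ℂ is holomorphic and satisfies the symmetric three-term relation ∑_{i ∈ ℤ/3ℤ} θ₁(τ, h_{i+1} − h_{i−1})·θ₁(τ, h_{i+1} + h_{i−1})·F(h_i) = 0 for all (h₁, h₂, h₃) ∈ ℂ³ (indices taken mod 3). Then F is quasi-periodic: F(h + 1) = F(h) and F(h + τ) = e^{−2πi(τ + 2h)}·F(h) for all h ∈ ℂ. -/
/-- The Jacobi theta function θ₁(τ,z). -/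
noncomputable def theta1 (τ z : ℂ) : ℂ :=
  -Complex.I * ∑' n : ℤ, (-1 : ℂ) ^ n *
    Complex.exp (Real.pi * Complex.I * τ * ((n : ℂ) + 1 / 2) ^ 2 +
      2 * Real.pi * Complex.I * ((n : ℂ) + 1 / 2) * z)

open Complex in
/-- The zeroth Fourier coefficient of `jacobiTheta₂` in its first variable is `1`. -/
lemma intervalIntegral_jacobiTheta₂ {τ : ℂ} (hτ : 0 < τ.im) :
    ∫ x in (0 : ℝ)..1, jacobiTheta₂ x τ = 1 := by
  have hnorm (n : ℤ) (x : ℝ) : ‖jacobiTheta₂_term n x τ‖ = ‖jacobiTheta₂_term n 0 τ‖ := by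
    simp [norm_jacobiTheta₂_term]
  have hcont (n : ℤ) : Continuous fun x : ℝ ↦ jacobiTheta₂_term n x τ := by
    unfold jacobiTheta₂_term
    fun_prop
  have hsum : Summable fun n : ℤ ↦ ‖jacobiTheta₂_term n 0 τ‖ :=
    ((summable_jacobiTheta₂_term_iff 0 τ).mpr hτ).norm
  have key : HasSum (fun n : ℤ ↦ ∫ x in (0 : ℝ)..1, jacobiTheta₂_term n x τ)
      (∫ x in (0 : ℝ)..1, jacobiTheta₂ x τ) :=
    intervalIntegral.hasSum_integral_of_dominated_convergence
      (fun n _ ↦ ‖jacobiTheta₂_term n 0 τ‖)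
      (fun n ↦ (hcont n).aestronglyMeasurable)
      (fun n ↦ .of_forall fun x _ ↦ (hnorm n x).le)
      (.of_forall fun _ _ ↦ hsum)
      intervalIntegrable_const
      (.of_forall fun x _ ↦ hasSum_jacobiTheta₂_term x hτ)
  refine key.unique ?_
  have hzero : ∫ x in (0 : ℝ)..1, jacobiTheta₂_term 0 x τ = 1 := by
    simp [jacobiTheta₂_term]
  rw [← hzero]
  refine hasSum_single 0 fun n hn ↦ ?_
  have hc : 2 * (Real.pi : ℂ) * I * n ≠ 0 :=
    mul_ne_zero two_pi_I_ne_zero (Int.cast_ne_zero.mpr hn)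
  have hexp : exp (2 * (Real.pi : ℂ) * I * n) = 1 :=
    exp_eq_one_iff.mpr ⟨n, by ring⟩
  simp only [jacobiTheta₂_term, exp_add]
  rw [intervalIntegral.integral_mul_const, integral_exp_mul_complex hc]
  simp [hexp]

lemma exists_jacobiTheta₂_ne_zero {τ : ℂ} (hτ : 0 < τ.im) : ∃ z, jacobiTheta₂ z τ ≠ 0 := by
  by_contra! h
  simpa [h] using intervalIntegral_jacobiTheta₂ hτ

open Complex in
lemma theta1_eq_jacobiTheta₂ (τ z : ℂ) :
    theta1 τ z = -I * (exp (Real.pi * I * τ / 4 + Real.pi * I * z) *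
      jacobiTheta₂ (z + 1 / 2 + τ / 2) τ) := by
  rw [theta1, jacobiTheta₂,
    ← tsum_mul_left (a := exp (Real.pi * I * τ / 4 + Real.pi * I * z))]
  congr 1
  refine tsum_congr fun n ↦ ?_
  rw [jacobiTheta₂_term, ← exp_pi_mul_I, ← exp_int_mul, ← exp_add, ← exp_add]
  congr 1
  ring

lemma exists_theta1_ne_zero {τ : ℂ} (hτ : 0 < τ.im) : ∃ z, theta1 τ z ≠ 0 := by
  obtain ⟨z, hz⟩ := exists_jacobiTheta₂_ne_zero hτ
  refine ⟨z - 1 / 2 - τ / 2, ?_⟩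
  rw [theta1_eq_jacobiTheta₂, show z - 1 / 2 - τ / 2 + 1 / 2 + τ / 2 = z by ring]
  exact mul_ne_zero (neg_ne_zero.mpr Complex.I_ne_zero) (mul_ne_zero (Complex.exp_ne_zero _) hz)

open Complex in
lemma theta1_add_one (τ z : ℂ) : theta1 τ (z + 1) = -theta1 τ z := by
  simp only [theta1_eq_jacobiTheta₂]
  rw [show z + 1 + 1 / 2 + τ / 2 = z + 1 / 2 + τ / 2 + 1 by ring, jacobiTheta₂_add_left,
    show (Real.pi : ℂ) * I * τ / 4 + Real.pi * I * (z + 1) =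
      Real.pi * I * τ / 4 + Real.pi * I * z + Real.pi * I by ring, exp_add _ (Real.pi * I : ℂ),
    exp_pi_mul_I]
  ring

open Complex in
lemma theta1_add_tau (τ z : ℂ) :
    theta1 τ (z + τ) = -exp (-(Real.pi * I) * (τ + 2 * z)) * theta1 τ z := by
  simp only [theta1_eq_jacobiTheta₂]
  rw [show z + τ + 1 / 2 + τ / 2 = z + 1 / 2 + τ / 2 + τ by ring, jacobiTheta₂_add_left']
  have h : exp (Real.pi * I * τ / 4 + Real.pi * I * (z + τ)) *
        exp (-Real.pi * I * (τ + 2 * (z + 1 / 2 + τ / 2))) =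
      -exp (-(Real.pi * I) * (τ + 2 * z)) * exp (Real.pi * I * τ / 4 + Real.pi * I * z) := by
    have hneg : (-1 : ℂ) = exp (-(Real.pi * I)) := by rw [exp_neg, exp_pi_mul_I]; norm_num
    rw [neg_eq_neg_one_mul (exp (-(Real.pi * I) * (τ + 2 * z))), hneg,
      ← exp_add, ← exp_add, ← exp_add]
    congr 1
    ring
  linear_combination (-I * jacobiTheta₂ (z + 1 / 2 + τ / 2) τ) * h

lemma theta1_sub_one (τ z : ℂ) : theta1 τ (z - 1) = -theta1 τ z := by
  rw [← neg_eq_iff_eq_neg, ← theta1_add_one, sub_add_cancel]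

open Complex in
lemma theta1_sub_tau (τ z : ℂ) :
    theta1 τ (z - τ) = -exp (-(Real.pi * I) * (τ - 2 * z)) * theta1 τ z := by
  have h := theta1_add_tau τ (z - τ)
  rw [sub_add_cancel] at h
  have hexp : exp (-(Real.pi * I) * (τ - 2 * z)) *
      exp (-(Real.pi * I) * (τ + 2 * (z - τ))) = 1 := by
    rw [← exp_add, ← exp_zero]
    congr 1
    ring
  rw [h]
  linear_combination -theta1 τ (z - τ) * hexp

/-- A holomorphic function F : ℂ → ℂ satisfying the symmetric three-term
theta relation is quasi-periodic: F(h+1) = F(h) and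
F(h+τ) = e^{−2πi(τ+2h)} F(h). -/
theorem statement3 (τ : ℂ) (hτ : 0 < τ.im) (F : ℂ → ℂ) (hF : Differentiable ℂ F)
    (heq : ∀ h₁ h₂ h₃ : ℂ,
      theta1 τ (h₂ - h₃) * theta1 τ (h₂ + h₃) * F h₁ +
      theta1 τ (h₃ - h₁) * theta1 τ (h₃ + h₁) * F h₂ +
      theta1 τ (h₁ - h₂) * theta1 τ (h₁ + h₂) * F h₃ = 0) :
    ∀ h : ℂ, F (h + 1) = F h ∧
      F (h + τ) = Complex.exp (-(2 * Real.pi * Complex.I) * (τ + 2 * h)) * F h := by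
  intro h
  obtain ⟨u, hu⟩ := exists_theta1_ne_zero hτ
  have hbase := heq h u 0
  simp only [sub_zero, add_zero, zero_sub, zero_add] at hbase
  constructor
  · have hshift := heq (h + 1) u 0
    rw [sub_zero, add_zero, zero_add, show 0 - (h + 1) = -h - 1 by ring,
      show h + 1 - u = h - u + 1 by ring, show h + 1 + u = h + u + 1 by ring,
      theta1_sub_one, theta1_add_one, theta1_add_one, theta1_add_one] at hshift
    refine mul_left_cancel₀ (mul_ne_zero hu hu) ?_
    linear_combination hshift - hbase
  · have hshift := heq (h + τ) u 0
    rw [sub_zero, add_zero, zero_add, show 0 - (h + τ) = -h - τ by ring,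
      show h + τ - u = h - u + τ by ring, show h + τ + u = h + u + τ by ring,
      theta1_sub_tau, theta1_add_tau, theta1_add_tau, theta1_add_tau] at hshift
    have hexp₁ : Complex.exp (-(Real.pi * Complex.I) * (τ - 2 * -h)) *
        Complex.exp (-(Real.pi * Complex.I) * (τ + 2 * h)) =
        Complex.exp (-(2 * Real.pi * Complex.I) * (τ + 2 * h)) := by
      rw [← Complex.exp_add]
      congr 1
      ring
    have hexp₂ : Complex.exp (-(Real.pi * Complex.I) * (τ + 2 * (h - u))) *
        Complex.exp (-(Real.pi * Complex.I) * (τ + 2 * (h + u))) =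
        Complex.exp (-(2 * Real.pi * Complex.I) * (τ + 2 * h)) := by
      rw [← Complex.exp_add]
      congr 1
      ring
    refine mul_left_cancel₀ (mul_ne_zero hu hu) ?_
    linear_combination hshift -
      Complex.exp (-(2 * Real.pi * Complex.I) * (τ + 2 * h)) * hbase -
      theta1 τ (-h) * theta1 τ h * F u * hexp₁ -
      theta1 τ (h - u) * theta1 τ (h + u) * F 0 * hexp₂
end

section
/- Let Λ be a positive definite even unimodular lattice that is generated (over ℤ) by its roots, and fix τ in the upper half-plane ℍ. Suppose f : Λ⊗ℂ → ℂ is holomorphic and satisfies f(m + α) = f(m) and f(m + τα) = e^{−2πi(τ + α·m)}·f(m) for every root α of Λ and every m ∈ Λ⊗ℂ. Then there exists a constant c ∈ ℂ such that f(m) = c·θ_Λ(τ, m) for all m ∈ Λ⊗ℂ. -/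
/-- The standard dot product on ℝ^N. -/
def dotR {N : ℕ} (x y : Fin N → ℝ) : ℝ := ∑ i, x i * y i

/-- The bilinear extension of the dot product to the complexification ℂ^N. -/
noncomputable def dotC {N : ℕ} (m : Fin N → ℂ) (w : Fin N → ℝ) : ℂ := ∑ i, m i * (w i : ℂ)

/-- The theta function of a lattice Λ ⊆ ℝ^N. -/
noncomputable def thetaLat {N : ℕ} (Λ : Submodule ℤ (Fin N → ℝ)) (τ : ℂ) (m : Fin N → ℂ) : ℂ :=
  ∑' w : Λ, Complex.exp (2 * Real.pi * Complex.I *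
    (τ * (dotR (w : Fin N → ℝ) (w : Fin N → ℝ) : ℂ) / 2 + dotC m (w : Fin N → ℝ)))

open MeasureTheory Filter Topology Set

theorem differentiable_setIntegral_of_continuous {X : Type*} [TopologicalSpace X]
    [SecondCountableTopology X] [MeasurableSpace X] [OpensMeasurableSpace X]
    {μ : Measure X} [IsFiniteMeasureOnCompacts μ] {s K : Set X} (hs : MeasurableSet s)
    (hK : IsCompact K) (hsK : s ⊆ K) {G : ℂ → X → ℂ}
    (hG : Continuous (Function.uncurry G)) (hGd : ∀ x, Differentiable ℂ fun z => G z x) :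
    Differentiable ℂ fun z => ∫ x in s, G z x ∂μ := by
  intro z₀
  obtain ⟨C, hC⟩ := ((isCompact_closedBall z₀ 2).prod hK).exists_bound_of_continuousOn
    hG.continuousOn
  have hμs : μ s ≠ ⊤ := ((measure_mono hsK).trans_lt hK.measure_lt_top).ne
  have : IsFiniteMeasure (μ.restrict s) := ⟨by simpa using hμs.lt_top⟩
  have hcont : ∀ z, Continuous (G z) := fun z => hG.comp (Continuous.prodMk_right z)
  refine (hasDerivAt_integral_of_dominated_loc_of_deriv_le (F' := fun z x => deriv (G · x) z)
    (bound := fun _ => C / 1)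
    (Metric.ball_mem_nhds z₀ one_pos) (Eventually.of_forall fun z =>
      (hcont z).aestronglyMeasurable) ?_ ?_ ?_ (integrable_const _) ?_).2.differentiableAt
  · refine Integrable.of_bound (hcont z₀).aestronglyMeasurable C ?_
    filter_upwards [ae_restrict_mem hs] with x hx
    exact hC (z₀, x) ⟨by simp, hsK hx⟩
  · have h := (stronglyMeasurable_deriv_with_param (𝕜 := ℂ) (f := fun (x : X) (z : ℂ) => G z x)
      (hG.comp continuous_swap))
    exact (h.comp_measurable (measurable_id.prodMk measurable_const)).aestronglyMeasurable
  · filter_upwards [ae_restrict_mem hs] with x hx z hz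
    refine Complex.norm_deriv_le_of_forall_mem_sphere_norm_le one_pos (hGd x).diffContOnCl ?_
    intro w hw
    refine hC (w, x) ⟨?_, hsK hx⟩
    simp only [Metric.mem_ball, mem_sphere_iff_norm, Metric.mem_closedBall] at *
    calc dist w z₀ ≤ dist w z + dist z z₀ := dist_triangle _ _ _
      _ ≤ 2 := by rw [dist_eq_norm w z, hw]; linarith
  · exact Eventually.of_forall fun x z _ => (hGd x z).hasDerivAt

section Torus

open UnitAddTorus Complex

noncomputable local instance : MeasureSpace UnitAddCircle := ⟨AddCircle.haarAddCircle⟩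

local instance : Measure.IsAddHaarMeasure (volume : Measure UnitAddCircle) :=
  inferInstanceAs (Measure.IsAddHaarMeasure AddCircle.haarAddCircle)

local instance : IsProbabilityMeasure (volume : Measure UnitAddCircle) :=
  inferInstanceAs (IsProbabilityMeasure AddCircle.haarAddCircle)

variable {ι : Type*}

/-- A function on `ℂ^ι` is unit periodic if it is invariant under translation by `ℤ^ι`. -/
def UnitPeriodic (F : (ι → ℂ) → ℂ) : Prop :=
  ∀ (n : ι → ℤ) (z : ι → ℂ), F (z + fun i => (n i : ℂ)) = F z

theorem UnitPeriodic.comp_add_right {F : (ι → ℂ) → ℂ} (hF : UnitPeriodic F) (v : ι → ℂ) :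
    UnitPeriodic fun z => F (z + v) := fun n z => by
  simp only [add_right_comm z, hF n]

/-- The restriction to `ℝ^ι` of a unit periodic function, as a function on the torus. -/
noncomputable def torusLift (F : (ι → ℂ) → ℂ) (t : UnitAddTorus ι) : ℂ :=
  F fun i => ((AddCircle.equivIco (1 : ℝ) 0 (t i) : ℝ) : ℂ)

theorem torusLift_coe {F : (ι → ℂ) → ℂ} (hF : UnitPeriodic F) (x : ι → ℝ) :
    torusLift F (fun i => (x i : UnitAddCircle)) = F fun i => (x i : ℂ) := by
  rw [← hF fun i => -toIcoDiv one_pos (0 : ℝ) (x i), torusLift]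
  congr 1
  funext i
  change ((toIcoMod one_pos (0 : ℝ) (x i) : ℝ) : ℂ) = _
  simp [toIcoMod, sub_eq_add_neg]

theorem UnitAddTorus.coe_surjective :
    Function.Surjective fun (x : ι → ℝ) (i : ι) => (x i : UnitAddCircle) := fun t =>
  ⟨fun i => AddCircle.equivIco (1 : ℝ) 0 (t i), funext fun _ => AddCircle.coe_equivIco⟩

theorem continuous_torusLift {F : (ι → ℂ) → ℂ} (hF : UnitPeriodic F) (hc : Continuous F) :
    Continuous (torusLift F) := by
  have hq : IsOpenQuotientMap (Pi.map fun (_ : ι) (x : ℝ) => (x : UnitAddCircle)) :=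
    IsOpenQuotientMap.piMap fun _ => QuotientAddGroup.isOpenQuotientMap_mk
  rw [← hq.continuous_comp_iff]
  have : torusLift F ∘ (Pi.map fun (_ : ι) (x : ℝ) => (x : UnitAddCircle)) =
      fun x : ι → ℝ => F fun i => (x i : ℂ) := funext fun x => torusLift_coe hF x
  rw [this]
  fun_prop

variable [Fintype ι]

theorem mFourier_coe (n : ι → ℤ) (x : ι → ℝ) :
    mFourier n (fun i => (x i : UnitAddCircle)) =
      exp (2 * Real.pi * I * ∑ i, (n i : ℂ) * x i) := by
  simp only [mFourier, ContinuousMap.coe_mk, fourier_coe_apply, ← Complex.exp_sum,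
    Finset.mul_sum, ofReal_one, div_one, mul_assoc]

/-- The Fourier coefficients along `ℝ^ι` of a unit periodic function on `ℂ^ι`. -/
noncomputable def periodCoeff (F : (ι → ℂ) → ℂ) (n : ι → ℤ) : ℂ :=
  mFourierCoeff (torusLift F) n

theorem periodCoeff_const_mul (c : ℂ) (F : (ι → ℂ) → ℂ) (n : ι → ℤ) :
    periodCoeff (fun z => c * F z) n = c * periodCoeff F n := by
  simp only [periodCoeff, mFourierCoeff, torusLift, smul_eq_mul, ← integral_const_mul]
  congr 1
  funext t
  ring

theorem periodCoeff_exp_mul (k : ι → ℤ) (F : (ι → ℂ) → ℂ) (n : ι → ℤ) :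
    periodCoeff (fun z => exp (-(2 * Real.pi * I) * ∑ i, (k i : ℂ) * z i) * F z) n =
      periodCoeff F (n + k) := by
  simp only [periodCoeff, mFourierCoeff, smul_eq_mul]
  congr 1
  funext t
  have hk : exp (-(2 * Real.pi * I) *
      ∑ i, (k i : ℂ) * ((AddCircle.equivIco (1 : ℝ) 0 (t i) : ℝ) : ℂ)) = mFourier (-k) t := by
    have ht : t = fun i => ((AddCircle.equivIco (1 : ℝ) 0 (t i) : ℝ) : UnitAddCircle) :=
      funext fun _ => AddCircle.coe_equivIco.symm
    conv_rhs => rw [ht, mFourier_coe]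
    simp
  rw [neg_add, mFourier_add]
  exact (congrArg (fun u => mFourier (-n) t * (u * torusLift F t)) hk).trans (mul_assoc _ _ _).symm

theorem periodCoeff_comp_add_ofReal {F : (ι → ℂ) → ℂ} (hF : UnitPeriodic F) (n : ι → ℤ)
    (x : ι → ℝ) :
    periodCoeff (fun z => F (z + fun i => (x i : ℂ))) n =
      exp (2 * Real.pi * I * ∑ i, (n i : ℂ) * x i) * periodCoeff F n := by
  simp only [periodCoeff, mFourierCoeff, smul_eq_mul]
  rw [← integral_add_right_eq_self (fun t => mFourier (-n) t * torusLift F t)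
    (fun i => (x i : UnitAddCircle)), ← integral_const_mul]
  congr 1
  funext t
  obtain ⟨y, rfl⟩ := UnitAddTorus.coe_surjective t
  have h1 := torusLift_coe (hF.comp_add_right fun i => (x i : ℂ)) y
  have h2 : ((fun i => (y i : UnitAddCircle)) + fun i => (x i : UnitAddCircle)) =
      fun i => ((y i + x i : ℝ) : UnitAddCircle) := rfl
  dsimp only at h1 ⊢
  rw [h1, h2, torusLift_coe hF, mFourier_coe, mFourier_coe, ← mul_assoc, ← exp_add]
  congr 2
  · simp only [Pi.neg_apply, Int.cast_neg, ofReal_add, mul_add, Finset.sum_add_distrib, neg_mul,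
      Finset.sum_neg_distrib]
    ring
  · funext i
    simp

theorem periodCoeff_comp_add_smul {F : (ι → ℂ) → ℂ} (hF : UnitPeriodic F)
    (hd : Differentiable ℂ F) (n : ι → ℤ) (z : ℂ) (x : ι → ℝ) :
    periodCoeff (fun w => F (w + z • fun i => (x i : ℂ))) n =
      exp (2 * Real.pi * I * (z * ∑ i, (n i : ℂ) * x i)) * periodCoeff F n := by
  have hdiff : Differentiable ℂ
      fun z : ℂ => periodCoeff (fun w => F (w + z • fun i => (x i : ℂ))) n := by
    have hrw : ∀ z : ℂ, periodCoeff (fun w => F (w + z • fun i => (x i : ℂ))) n =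
        ∫ y : ι → ℝ in {y : ι → ℝ | ∀ i, y i ∈ Ioc (0 : ℝ) (0 + 1)},
          exp (2 * Real.pi * I * ∑ i, ((-n) i : ℂ) * y i) *
            F ((fun i => (y i : ℂ)) + z • fun i => (x i : ℂ)) := by
      intro z
      rw [periodCoeff, mFourierCoeff_eq_integral _ _ 0]
      refine integral_congr_ae (Eventually.of_forall fun y => ?_)
      dsimp only
      rw [torusLift_coe (hF.comp_add_right _), mFourier_coe, smul_eq_mul]
    simp_rw [hrw]
    refine differentiable_setIntegral_of_continuous (K := Icc 0 1) ?_ isCompact_Icc ?_ ?_ ?_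
    · exact MeasurableSet.univ_pi' fun i => measurableSet_Ioc
    · intro y hy
      exact ⟨fun i => (hy i).1.le, fun i => by simpa using (hy i).2⟩
    · have := hd.continuous
      simp only [Function.uncurry_def]
      fun_prop
    · intro y
      fun_prop
  have hfun : (fun z : ℂ => periodCoeff (fun w => F (w + z • fun i => (x i : ℂ))) n) =
      fun z => exp (2 * Real.pi * I * (z * ∑ i, (n i : ℂ) * x i)) * periodCoeff F n := by
    refine AnalyticOnNhd.eq_of_frequently_eq (z₀ := 0)
      (fun z _ => hdiff.analyticAt z)
      (fun z _ => Differentiable.analyticAt (by fun_prop) z) ?_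
    have hreal : ∀ r : ℝ, periodCoeff (fun w => F (w + (r : ℂ) • fun i => (x i : ℂ))) n =
        exp (2 * Real.pi * I * (r * ∑ i, (n i : ℂ) * x i)) * periodCoeff F n := by
      intro r
      convert periodCoeff_comp_add_ofReal hF n (r • x) using 4
      · congr 1
        funext i
        simp
      · simp [Finset.mul_sum, mul_left_comm]
    have htend : Tendsto (fun r : ℝ => (r : ℂ)) (𝓝[≠] 0) (𝓝[≠] 0) := by
      refine tendsto_nhdsWithin_iff.2 ⟨?_, ?_⟩
      · exact (continuous_ofReal.tendsto' 0 0 (by simp)).mono_left nhdsWithin_le_nhds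
      · filter_upwards [self_mem_nhdsWithin] with r hr
        simpa using hr
    exact htend.frequently (Eventually.of_forall hreal).frequently
  exact congrFun hfun z

theorem periodCoeff_comp_add {F : (ι → ℂ) → ℂ} (hF : UnitPeriodic F)
    (hd : Differentiable ℂ F) (n : ι → ℤ) (v : ι → ℂ) :
    periodCoeff (fun w => F (w + v)) n =
      exp (2 * Real.pi * I * ∑ i, (n i : ℂ) * v i) * periodCoeff F n := by
  have h1 := periodCoeff_comp_add_smul
    (hF.comp_add_right (I • fun i => ((v i).im : ℂ))) (by fun_prop) n 1 fun i => (v i).re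
  rw [periodCoeff_comp_add_smul hF hd, ← mul_assoc, ← exp_add] at h1
  have hv : ∀ w : ι → ℂ, w + v =
      w + (1 : ℂ) • (fun i => ((v i).re : ℂ)) + I • fun i => ((v i).im : ℂ) := by
    intro w
    funext i
    conv_lhs => rw [Pi.add_apply, ← re_add_im (v i)]
    simp [mul_comm, add_assoc]
  simp_rw [hv, h1]
  congr 2
  rw [← mul_add, one_mul, Finset.mul_sum, ← Finset.sum_add_distrib]
  congr 2
  funext i
  conv_rhs => rw [← re_add_im (v i)]
  ring

theorem hasSum_periodCoeff {F : (ι → ℂ) → ℂ} (hF : UnitPeriodic F) (hd : Differentiable ℂ F)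
    (v : ι → ℂ)
    (hs : Summable fun n : ι → ℤ =>
      exp (2 * Real.pi * I * ∑ i, (n i : ℂ) * v i) * periodCoeff F n) :
    HasSum (fun n : ι → ℤ => exp (2 * Real.pi * I * ∑ i, (n i : ℂ) * v i) * periodCoeff F n)
      (F v) := by
  have hG := hF.comp_add_right v
  let g : C(UnitAddTorus ι, ℂ) :=
    ⟨torusLift fun z => F (z + v), continuous_torusLift hG (hd.continuous.comp (by fun_prop))⟩
  have hcoeff : ∀ n, mFourierCoeff g n =
      exp (2 * Real.pi * I * ∑ i, (n i : ℂ) * v i) * periodCoeff F n :=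
    fun n => periodCoeff_comp_add hF hd n v
  have h := hasSum_mFourier_series_apply_of_summable (f := g)
    (by simpa only [funext hcoeff] using hs) fun i => ((0 : ℝ) : UnitAddCircle)
  have hg : g (fun i => ((0 : ℝ) : UnitAddCircle)) = F v := by
    refine (torusLift_coe hG fun _ => 0).trans ?_
    congr 1
    funext i
    simp
  simpa only [hcoeff, hg, mFourier_coe, ofReal_zero, mul_zero, Finset.sum_const_zero, exp_zero,
    smul_eq_mul, mul_one] using h

end Torus

section Lattice

open Complex Module

variable {N : ℕ}

theorem dotR_add_left (x y z : Fin N → ℝ) : dotR (x + y) z = dotR x z + dotR y z :=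
  add_dotProduct x y z

theorem dotR_add_right (x y z : Fin N → ℝ) : dotR x (y + z) = dotR x y + dotR x z :=
  dotProduct_add x y z

theorem dotR_smul_left (c : ℝ) (x y : Fin N → ℝ) : dotR (c • x) y = c * dotR x y :=
  smul_dotProduct c x y

theorem dotR_comm (x y : Fin N → ℝ) : dotR x y = dotR y x :=
  dotProduct_comm x y

theorem dotR_zero_left (x : Fin N → ℝ) : dotR 0 x = 0 :=
  zero_dotProduct x

theorem dotR_neg_left (x y : Fin N → ℝ) : dotR (-x) y = -dotR x y :=
  neg_dotProduct x y

theorem dotR_sum_left {κ : Type*} (s : Finset κ) (x : κ → Fin N → ℝ) (y : Fin N → ℝ) :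
    dotR (∑ j ∈ s, x j) y = ∑ j ∈ s, dotR (x j) y :=
  sum_dotProduct s x y

theorem dotR_self_eq_zero {x : Fin N → ℝ} : dotR x x = 0 ↔ x = 0 :=
  dotProduct_self_eq_zero

theorem sq_norm_le_dotR_self (x : Fin N → ℝ) : ‖x‖ ^ 2 ≤ dotR x x := by
  have hnonneg : 0 ≤ dotR x x := Finset.sum_nonneg fun i _ => mul_self_nonneg (x i)
  rw [← Real.le_sqrt (norm_nonneg x) hnonneg, pi_norm_le_iff_of_nonneg (Real.sqrt_nonneg _)]
  intro i
  rw [Real.norm_eq_abs]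
  refine Real.abs_le_sqrt ?_
  rw [sq]
  exact Finset.single_le_sum (f := fun i => x i * x i) (fun i _ => mul_self_nonneg (x i))
    (Finset.mem_univ i)

theorem dotC_sum_smul_ofReal {κ : Type*} [Fintype κ] (z : κ → ℂ) (b : κ → Fin N → ℝ)
    (w : Fin N → ℝ) :
    dotC (∑ j, z j • fun i => (b j i : ℂ)) w = ∑ j, z j * (dotR (b j) w : ℂ) := by
  simp only [dotC, dotR, Finset.sum_apply, Pi.smul_apply, smul_eq_mul, Finset.sum_mul, ofReal_sum,
    ofReal_mul, Finset.mul_sum]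
  rw [Finset.sum_comm]
  simp only [mul_assoc]

theorem discreteTopology_of_even {Λ : Submodule ℤ (Fin N → ℝ)}
    (heven : ∀ w ∈ Λ, ∃ k : ℤ, dotR w w = 2 * k) : DiscreteTopology Λ := by
  refine discreteTopology_of_isOpen_singleton_zero ?_
  have hcont : Continuous fun w : Λ => dotR (w : Fin N → ℝ) w := by
    unfold dotR
    exact continuous_finsetSum _ fun i _ => ((continuous_apply i).comp continuous_subtype_val).mul
      ((continuous_apply i).comp continuous_subtype_val)
  convert! (isOpen_Iio (a := (2 : ℝ))).preimage hcont
  ext w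
  simp only [mem_singleton_iff, mem_preimage, mem_Iio]
  constructor
  · rintro rfl
    simp [dotR]
  · intro h
    obtain ⟨k, hk⟩ := heven w w.2
    have h0 : 0 ≤ dotR (w : Fin N → ℝ) w := Finset.sum_nonneg fun i _ => mul_self_nonneg _
    rw [hk] at h h0
    have hk1 : k < 1 := by exact_mod_cast (by linarith : (k : ℝ) < 1)
    have hk0 : 0 ≤ k := by exact_mod_cast (by linarith : (0 : ℝ) ≤ k)
    have : k = 0 := by omega
    rw [this] at hk
    exact Subtype.ext (dotR_self_eq_zero.1 (by simpa using hk))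

theorem span_eq_top_of_even_of_selfDual {Λ : Submodule ℤ (Fin N → ℝ)}
    (heven : ∀ w ∈ Λ, ∃ k : ℤ, dotR w w = 2 * k)
    (hselfdual : ∀ x : Fin N → ℝ, (∀ w ∈ Λ, ∃ k : ℤ, dotR x w = k) → x ∈ Λ) :
    Submodule.span ℝ (Λ : Set (Fin N → ℝ)) = ⊤ := by
  by_contra hne
  obtain ⟨φ, hφ0, hφ⟩ := Submodule.exists_le_ker_of_lt_top _ (lt_top_iff_ne_top.2 hne)
  set x : Fin N → ℝ := fun i => φ fun j => if i = j then 1 else 0 with hx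
  have hφx : ∀ v, φ v = dotR x v := by
    intro v
    conv_lhs => rw [LinearMap.pi_apply_eq_sum_univ φ v]
    simp only [dotR, hx, smul_eq_mul, mul_comm]
  have hx0 : dotR x x ≠ 0 := by
    rw [Ne, dotR_self_eq_zero]
    intro h
    refine hφ0 (LinearMap.ext fun v => ?_)
    rw [hφx, h, dotR_zero_left, LinearMap.zero_apply]
  have hpos : 0 < dotR x x :=
    lt_of_le_of_ne (Finset.sum_nonneg fun i _ => mul_self_nonneg (x i)) hx0.symm
  have hmem : (Real.sqrt (dotR x x))⁻¹ • x ∈ Λ := by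
    refine hselfdual _ fun w hw => ⟨0, ?_⟩
    have : φ w = 0 := hφ (Submodule.subset_span hw)
    rw [dotR_smul_left, ← hφx w, this]
    simp
  obtain ⟨k, hk⟩ := heven _ hmem
  rw [dotR_smul_left, dotR_comm x (_ • x), dotR_smul_left, ← mul_assoc, ← mul_inv,
    Real.mul_self_sqrt hpos.le, inv_mul_cancel₀ hx0] at hk
  have : (1 : ℤ) = 2 * k := by exact_mod_cast hk
  omega

theorem exists_basis_span_eq {Λ : Submodule ℤ (Fin N → ℝ)} [DiscreteTopology Λ]
    (htop : Submodule.span ℝ (Λ : Set (Fin N → ℝ)) = ⊤) :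
    ∃ b : Basis (Fin N) ℝ (Fin N → ℝ), Submodule.span ℤ (range b) = Λ := by
  have : IsZLattice ℝ Λ := ⟨htop⟩
  have : Module.Free ℤ Λ := ZLattice.module_free ℝ Λ
  let c := (Free.chooseBasis ℤ Λ).ofZLatticeBasis ℝ Λ
  have hc : Submodule.span ℤ (range c) = Λ := (Free.chooseBasis ℤ Λ).ofZLatticeBasis_span ℝ
  refine ⟨c.reindex (c.indexEquiv (Pi.basisFun ℝ (Fin N))), ?_⟩
  rw [Basis.range_reindex, hc]

/-- Pairing with a lattice basis identifies a self-dual lattice with `ℤ^N`. -/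
theorem exists_equiv_dotR_basis {Λ : Submodule ℤ (Fin N → ℝ)}
    (hintegral : ∀ v ∈ Λ, ∀ w ∈ Λ, ∃ k : ℤ, dotR v w = k)
    (hselfdual : ∀ x : Fin N → ℝ, (∀ w ∈ Λ, ∃ k : ℤ, dotR x w = k) → x ∈ Λ)
    (b : Basis (Fin N) ℝ (Fin N → ℝ)) (hb : Submodule.span ℤ (range b) = Λ) :
    ∃ e : Λ ≃ (Fin N → ℤ), ∀ (w : Λ) (j : Fin N), (e w j : ℝ) = dotR (b j) w := by
  have hbmem : ∀ j, b j ∈ Λ := fun j => hb ▸ Submodule.subset_span (mem_range_self j)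
  choose n hn using fun (w : Λ) (j : Fin N) => hintegral (b j) (hbmem j) w w.2
  let T : (Fin N → ℝ) →ₗ[ℝ] (Fin N → ℝ) := Matrix.mulVecLin (Matrix.of fun j => b j)
  have hT : ∀ x j, T x j = dotR (b j) x := fun x j => rfl
  have hTinj : Function.Injective T := by
    rw [← LinearMap.ker_eq_bot, LinearMap.ker_eq_bot']
    intro x hx
    rw [← dotR_self_eq_zero]
    conv_lhs => enter [1]; rw [← b.sum_repr x]
    rw [dotR_sum_left]
    refine Finset.sum_eq_zero fun j _ => ?_
    rw [dotR_smul_left, ← hT, hx]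
    simp
  have hTsurj : Function.Surjective T := LinearMap.injective_iff_surjective.1 hTinj
  refine ⟨Equiv.ofBijective n ⟨?_, ?_⟩, fun w j => (hn w j).symm⟩
  · intro v w hvw
    refine Subtype.ext (hTinj (funext fun j => ?_))
    rw [hT, hT, hn, hn, hvw]
  · intro k
    obtain ⟨x, hx⟩ := hTsurj fun j => (k j : ℝ)
    have hxb : ∀ j, dotR (b j) x = k j := fun j => by rw [← hT, hx]
    have hxmem : x ∈ Λ := by
      refine hselfdual x fun w hw => ?_
      rw [← hb] at hw
      induction hw using Submodule.span_induction with
      | mem w hw =>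
        obtain ⟨j, rfl⟩ := hw
        exact ⟨k j, by rw [dotR_comm, hxb]⟩
      | zero => exact ⟨0, by simp [dotR]⟩
      | add v w _ _ hv hw =>
        obtain ⟨p, hp⟩ := hv
        obtain ⟨q, hq⟩ := hw
        exact ⟨p + q, by rw [dotR_add_right, hp, hq, Int.cast_add]⟩
      | smul a w _ hw =>
        obtain ⟨q, hq⟩ := hw
        refine ⟨a * q, ?_⟩
        rw [dotR_comm, ← Int.cast_smul_eq_zsmul ℝ, dotR_smul_left, dotR_comm, hq, Int.cast_mul]
    refine ⟨⟨x, hxmem⟩, funext fun j => ?_⟩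
    have := hn ⟨x, hxmem⟩ j
    rw [hxb] at this
    exact_mod_cast this.symm

theorem summable_thetaLat (Λ : Submodule ℤ (Fin N → ℝ)) [DiscreteTopology Λ] {τ : ℂ}
    (hτ : 0 < τ.im) (m : Fin N → ℂ) :
    Summable fun w : Λ => exp (2 * Real.pi * I *
      (τ * (dotR (w : Fin N → ℝ) (w : Fin N → ℝ) : ℂ) / 2 + dotC m (w : Fin N → ℝ))) := by
  have hr := ZLattice.summable_norm_rpow Λ (-(Module.finrank ℤ Λ : ℝ) - 1) (by linarith)
  refine summable_of_isBigO hr ?_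
  have ha : -(Real.pi * τ.im) < 0 := neg_neg_of_pos (mul_pos Real.pi_pos hτ)
  have htend : Tendsto (fun w : Λ => ‖w‖) cofinite atTop := by
    have hclosed : IsClosed (Λ : Set (Fin N → ℝ)) :=
      AddSubgroup.isClosed_of_discrete (H := Λ.toAddSubgroup)
    have h1 : Tendsto (fun w : Λ => (w : Fin N → ℝ)) cofinite (cocompact _) :=
      tendsto_cofinite_cocompact_of_discrete
        hclosed.isClosedEmbedding_subtypeVal.tendsto_cocompact
    exact (tendsto_norm_cocompact_atTop (E := Fin N → ℝ)).comp h1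
  have hO := ((rexp_neg_quadratic_isLittleO_rpow_atTop ha (2 * Real.pi * ∑ i, |(m i).im|)
    (-(Module.finrank ℤ Λ : ℝ) - 1)).comp_tendsto htend).isBigO
  refine (Asymptotics.IsBigO.of_bound 1 (Eventually.of_forall fun w => ?_)).trans hO
  rw [one_mul, Complex.norm_exp, Function.comp_apply, Real.norm_eq_abs, Real.abs_exp]
  refine Real.exp_le_exp.2 ?_
  have hre : (2 * Real.pi * I * (τ * (dotR (w : Fin N → ℝ) w : ℂ) / 2 + dotC m w)).re =
      -(Real.pi * τ.im) * dotR (w : Fin N → ℝ) w -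
        2 * Real.pi * ∑ i, (m i).im * (w : Fin N → ℝ) i := by
    have him : (dotC m (w : Fin N → ℝ)).im = ∑ i, (m i).im * (w : Fin N → ℝ) i := by
      simp [dotC, Complex.im_sum]
    have h2 : (τ * (dotR (w : Fin N → ℝ) w : ℂ) / 2 + dotC m w).im =
        τ.im * dotR (w : Fin N → ℝ) w / 2 + ∑ i, (m i).im * (w : Fin N → ℝ) i := by
      rw [← him, add_im, div_ofNat_im, im_mul_ofReal]
    have h3 : ∀ u : ℂ, (2 * Real.pi * I * u).re = -(2 * Real.pi * u.im) := by
      intro u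
      simp
    rw [h3, h2]
    ring
  rw [hre]
  have hsum : -∑ i, (m i).im * (w : Fin N → ℝ) i ≤ (∑ i, |(m i).im|) * ‖w‖ := by
    rw [Finset.sum_mul, ← Finset.sum_neg_distrib]
    refine Finset.sum_le_sum fun i _ => (neg_le_abs _).trans ?_
    rw [abs_mul]
    exact mul_le_mul_of_nonneg_left (norm_le_pi_norm (w : Fin N → ℝ) i) (abs_nonneg _)
  have hsq := mul_le_mul_of_nonpos_left (sq_norm_le_dotR_self (w : Fin N → ℝ)) ha.le
  have hsum' := mul_le_mul_of_nonneg_left hsum (by positivity : 0 ≤ 2 * Real.pi)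
  have hnorm : ‖w‖ = ‖(w : Fin N → ℝ)‖ := rfl
  rw [← hnorm] at hsq
  linarith

theorem exists_eq_sum_smul_ofReal (b : Basis (Fin N) ℝ (Fin N → ℝ)) (m : Fin N → ℂ) :
    ∃ v : Fin N → ℂ, m = ∑ j, v j • fun i => (b j i : ℂ) := by
  refine ⟨fun j => b.repr (fun i => (m i).re) j + b.repr (fun i => (m i).im) j * I, ?_⟩
  funext i
  have hre := congrFun (b.sum_repr fun i => (m i).re) i
  have him := congrFun (b.sum_repr fun i => (m i).im) i
  rw [← re_add_im (m i), ← hre, ← him]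
  simp [Finset.sum_apply, add_mul, Finset.sum_add_distrib, Finset.sum_mul, mul_right_comm]

theorem root_induction {Λ : Submodule ℤ (Fin N → ℝ)}
    (hroots : Submodule.span ℤ {α : Fin N → ℝ | α ∈ Λ ∧ dotR α α = 2} = Λ) {p : Λ → Prop}
    (hroot : ∀ α : Λ, dotR (α : Fin N → ℝ) α = 2 → p α) (hzero : p 0)
    (hadd : ∀ v w, p v → p w → p (v + w)) (hneg : ∀ v, p v → p (-v)) (v : Λ) : p v := by
  have key : ∀ x ∈ AddSubgroup.closure {α : Fin N → ℝ | α ∈ Λ ∧ dotR α α = 2},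
      ∃ h : x ∈ Λ, p ⟨x, h⟩ := by
    intro x hx
    induction hx using AddSubgroup.closure_induction with
    | mem x hx => exact ⟨hx.1, hroot ⟨x, hx.1⟩ hx.2⟩
    | zero => exact ⟨Λ.zero_mem, hzero⟩
    | add x y _ _ hx hy =>
      obtain ⟨hx, hpx⟩ := hx
      obtain ⟨hy, hpy⟩ := hy
      exact ⟨Λ.add_mem hx hy, hadd ⟨x, hx⟩ ⟨y, hy⟩ hpx hpy⟩
    | neg x _ hx =>
      obtain ⟨hx, hpx⟩ := hx
      exact ⟨Λ.neg_mem hx, hneg ⟨x, hx⟩ hpx⟩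
  obtain ⟨_, h⟩ := key v <| by
    rw [← Submodule.span_int_eq_addSubgroupClosure, hroots]
    exact v.2
  exact h

/-- A function on the lattice transforming under root translations like the Fourier coefficients
of the theta function is a multiple of those coefficients. -/
theorem eq_exp_mul_of_root_translate {Λ : Submodule ℤ (Fin N → ℝ)}
    (hroots : Submodule.span ℤ {α : Fin N → ℝ | α ∈ Λ ∧ dotR α α = 2} = Λ) (τ : ℂ) (C : Λ → ℂ)
    (hC : ∀ α : Λ, dotR (α : Fin N → ℝ) α = 2 → ∀ w : Λ,
      C (w + α) = exp (2 * Real.pi * I * (τ * (1 + (dotR (α : Fin N → ℝ) w : ℂ)))) * C w) (v : Λ) :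
    C v = exp (2 * Real.pi * I * (τ * (dotR (v : Fin N → ℝ) v : ℂ) / 2)) * C 0 := by
  have key : ∀ v w : Λ, C (w + v) = exp (2 * Real.pi * I *
      (τ * ((dotR (v : Fin N → ℝ) v : ℂ) / 2 + (dotR (v : Fin N → ℝ) w : ℂ)))) * C w := by
    refine root_induction hroots ?_ ?_ ?_ ?_
    · intro α hα w
      rw [hC α hα, hα]
      simp
    · intro w
      simp [dotR_zero_left]
    · intro u v hu hv w
      rw [← add_assoc, hv, hu, ← mul_assoc, ← exp_add]
      congr 2
      simp only [Submodule.coe_add, dotR_add_left, dotR_add_right, ofReal_add]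
      rw [dotR_comm (v : Fin N → ℝ) u]
      ring
    · intro v hv w
      have h := hv (w + -v)
      rw [neg_add_cancel_right] at h
      rw [h, ← mul_assoc, ← exp_add]
      have hexp : ∀ u : ℂ, u = 0 → ∀ c : ℂ, c = exp u * c := by
        rintro _ rfl c
        simp
      refine hexp _ ?_ _
      simp only [Submodule.coe_add, Submodule.coe_neg, dotR_neg_left, dotR_add_right]
      rw [dotR_comm (v : Fin N → ℝ) (-v), dotR_neg_left]
      push_cast
      ring
  have h := key v 0
  rw [zero_add] at h
  rw [h]
  congr 3
  simp [dotR, mul_div_assoc]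

end Lattice

/-- If Λ is a positive definite even unimodular lattice generated by its roots
(realised as a self-dual even lattice in ℝ^N with the standard dot product),
and f is holomorphic on Λ⊗ℂ ≅ ℂ^N satisfying f(m + α) = f(m) and
f(m + τα) = e^{−2πi(τ + α·m)} f(m) for every root α, then f is a multiple
of the theta series of Λ. -/
theorem statement4 {N : ℕ} (Λ : Submodule ℤ (Fin N → ℝ))
    (heven : ∀ w ∈ Λ, ∃ k : ℤ, dotR w w = 2 * k)
    (hintegral : ∀ v ∈ Λ, ∀ w ∈ Λ, ∃ k : ℤ, dotR v w = k)
    (hselfdual : ∀ x : Fin N → ℝ, (∀ w ∈ Λ, ∃ k : ℤ, dotR x w = k) → x ∈ Λ)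
    (hroots : Submodule.span ℤ {α : Fin N → ℝ | α ∈ Λ ∧ dotR α α = 2} = Λ)
    (τ : ℂ) (hτ : 0 < τ.im)
    (f : (Fin N → ℂ) → ℂ) (hf : Differentiable ℂ f)
    (hper : ∀ α ∈ Λ, dotR α α = 2 → ∀ m : Fin N → ℂ,
      f (m + (fun i => (α i : ℂ))) = f m ∧
      f (m + τ • (fun i => (α i : ℂ))) =
        Complex.exp (-(2 * Real.pi * Complex.I) * (τ + dotC m α)) * f m) :
    ∃ c : ℂ, ∀ m : Fin N → ℂ, f m = c * thetaLat Λ τ m := by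
  have hdisc : DiscreteTopology Λ := discreteTopology_of_even heven
  obtain ⟨b, hb⟩ := exists_basis_span_eq (span_eq_top_of_even_of_selfDual heven hselfdual)
  obtain ⟨e, he⟩ := exists_equiv_dotR_basis hintegral hselfdual b hb
  have heC : ∀ (w : Λ) (j : Fin N), (e w j : ℂ) = (dotR (b j) w : ℂ) := fun w j => by
    rw [← he w j, Complex.ofReal_intCast]
  have headd : ∀ v w : Λ, e (v + w) = e v + e w := by
    intro v w
    funext j
    have h : (e (v + w) j : ℝ) = e v j + e w j := by
      simp only [he, Submodule.coe_add, dotR_add_right]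
    exact_mod_cast h
  have hbmem : ∀ j, b j ∈ Λ := fun j => hb ▸ Submodule.subset_span (mem_range_self j)
  have hperΛ : ∀ (v : Λ) (m : Fin N → ℂ), f (m + fun i => ((v : Fin N → ℝ) i : ℂ)) = f m := by
    refine root_induction hroots (fun α hα m => (hper α α.2 hα m).1) ?_ ?_ ?_
    · intro m
      congr 1
      funext i
      simp
    · intro v w hv hw m
      refine Eq.trans ?_ ((hw _).trans (hv m))
      congr 1
      funext i
      simp [add_assoc]
    · intro v hv m
      rw [← hv]
      congr 1
      funext i
      simp
  let B : (Fin N → ℂ) → Fin N → ℂ := fun z => ∑ j, z j • fun i => (b j i : ℂ)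
  have hBadd : ∀ y z, B (y + z) = B y + B z := fun y z => by
    simp only [B, Pi.add_apply, add_smul, Finset.sum_add_distrib]
  have hBrepr : ∀ (c : ℂ) (v : Fin N → ℝ),
      B (c • fun j => (b.repr v j : ℂ)) = c • fun i => (v i : ℂ) := by
    intro c v
    funext i
    conv_rhs => rw [Pi.smul_apply, ← b.sum_repr v]
    simp [B, Finset.sum_apply, Finset.mul_sum, mul_assoc]
  have hBdot : ∀ (z : Fin N → ℂ) (w : Λ), dotC (B z) w = ∑ j, (e w j : ℂ) * z j := by
    intro z w
    rw [dotC_sum_smul_ofReal]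
    simp only [heC, mul_comm]
  let F : (Fin N → ℂ) → ℂ := fun z => f (B z)
  have hFd : Differentiable ℂ F := hf.comp (by fun_prop)
  have hFper : UnitPeriodic F := by
    intro n z
    have hmem : ∑ j, n j • b j ∈ Λ := Λ.sum_mem fun j _ => Λ.smul_mem _ (hbmem j)
    change f (B (z + _)) = f (B z)
    rw [hBadd, ← hperΛ ⟨_, hmem⟩ (B z)]
    congr 2
    funext i
    simp [B, Finset.sum_apply]
  let C : Λ → ℂ := fun w => periodCoeff F (e w)
  have hC : ∀ α : Λ, dotR (α : Fin N → ℝ) α = 2 → ∀ w : Λ, C (w + α) =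
      Complex.exp (2 * Real.pi * Complex.I * (τ * (1 + (dotR (α : Fin N → ℝ) w : ℂ)))) * C w := by
    intro α hα w
    have hshift := periodCoeff_comp_add_smul hFper hFd (e w) τ fun j => b.repr α j
    have hdot : ∑ j, (e w j : ℂ) * (b.repr (α : Fin N → ℝ) j : ℂ) =
        (dotR (α : Fin N → ℝ) w : ℂ) := by
      conv_rhs => rw [← b.sum_repr (α : Fin N → ℝ)]
      rw [dotR_sum_left, Complex.ofReal_sum]
      simp only [dotR_smul_left, Complex.ofReal_mul, heC, mul_comm]
    have hquasi : (fun z => F (z + τ • fun j => (b.repr (α : Fin N → ℝ) j : ℂ))) =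
        fun z => Complex.exp (-(2 * Real.pi * Complex.I) * τ) *
          (Complex.exp (-(2 * Real.pi * Complex.I) * ∑ j, (e α j : ℂ) * z j) * F z) := by
      funext z
      change f (B _) = _
      rw [hBadd, hBrepr, (hper α α.2 hα _).2, hBdot, mul_add, Complex.exp_add, mul_assoc]
    rw [hquasi, hdot, periodCoeff_const_mul, periodCoeff_exp_mul, ← headd] at hshift
    change periodCoeff F (e (w + α)) = _ * periodCoeff F (e w)
    rw [mul_add, mul_one, mul_add, Complex.exp_add, mul_assoc, ← hshift, ← mul_assoc,
      ← Complex.exp_add]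
    simp
  have hCtheta := eq_exp_mul_of_root_translate hroots τ C hC
  refine ⟨C 0, fun m => ?_⟩
  obtain ⟨v, hv⟩ := exists_eq_sum_smul_ofReal b m
  have hterm : ((fun n : Fin N → ℤ => Complex.exp (2 * Real.pi * Complex.I *
      ∑ j, (n j : ℂ) * v j) * periodCoeff F n) ∘ e) = fun w : Λ => C 0 *
        Complex.exp (2 * Real.pi * Complex.I * (τ * (dotR (w : Fin N → ℝ) (w : Fin N → ℝ) : ℂ) / 2 +
          dotC m (w : Fin N → ℝ))) := by
    funext w
    have hm : dotC m (w : Fin N → ℝ) = ∑ j, (e w j : ℂ) * v j := by rw [hv, ← hBdot]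
    change _ * C w = _
    rw [hCtheta w, hm, mul_add, Complex.exp_add]
    ring
  have hsum := hasSum_periodCoeff hFper hFd v <| by
    rw [← e.summable_iff, hterm]
    exact (summable_thetaLat Λ hτ m).mul_left _
  rw [← e.hasSum_iff, hterm] at hsum
  have hFv : F v = f m := by rw [hv]
  rw [← hFv, ← hsum.tsum_eq, tsum_mul_left, thetaLat]
end

section
/- For every τ in the upper half-plane ℍ and all λ, ε₁, ε₂ ∈ ℂ, the following theta-function identity holds: θ₁(τ, ε₂)·θ₁(τ, λ + ε₂)·θ₂(2τ, λ + 2ε₁) − θ₁(τ, ε₁)·θ₁(τ, λ + ε₁)·θ₂(2τ, λ + 2ε₂) = θ₁(τ, ε₂ − ε₁)·θ₁(τ, λ + ε₁ + ε₂)·θ₂(2τ, λ). -/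
/-- The Jacobi theta function θ₂(τ,z). -/
noncomputable def theta2 (τ z : ℂ) : ℂ :=
  ∑' n : ℤ, Complex.exp (Real.pi * Complex.I * τ * ((n : ℂ) + 1 / 2) ^ 2 +
    2 * Real.pi * Complex.I * ((n : ℂ) + 1 / 2) * z)

open Complex in
/-- The general term of the series defining `theta2`, in terms of `jacobiTheta₂_term`. -/
lemma exp_half_integer_eq_jacobiTheta₂_term (τ z : ℂ) (n : ℤ) :
    exp (Real.pi * I * τ * ((n : ℂ) + 1 / 2) ^ 2 + 2 * Real.pi * I * ((n : ℂ) + 1 / 2) * z) =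
      exp (Real.pi * I * τ / 4 + Real.pi * I * z) * jacobiTheta₂_term n (z + τ / 2) τ := by
  rw [jacobiTheta₂_term, ← exp_add]
  congr 1
  ring

lemma summable_theta2_term {τ : ℂ} (hτ : 0 < τ.im) (z : ℂ) :
    Summable fun n : ℤ => Complex.exp (Real.pi * Complex.I * τ * ((n : ℂ) + 1 / 2) ^ 2 +
      2 * Real.pi * Complex.I * ((n : ℂ) + 1 / 2) * z) := by
  simp_rw [exp_half_integer_eq_jacobiTheta₂_term]
  exact ((summable_jacobiTheta₂_term_iff _ _).2 hτ).mul_left _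

lemma summable_theta1_term {τ : ℂ} (hτ : 0 < τ.im) (z : ℂ) :
    Summable fun n : ℤ => (-1 : ℂ) ^ n *
      Complex.exp (Real.pi * Complex.I * τ * ((n : ℂ) + 1 / 2) ^ 2 +
        2 * Real.pi * Complex.I * ((n : ℂ) + 1 / 2) * z) := by
  refine Summable.of_norm ?_
  simpa only [norm_mul, norm_zpow, norm_neg, norm_one, one_zpow, one_mul] using
    (summable_theta2_term hτ z).norm

lemma theta2_neg (τ z : ℂ) : theta2 τ (-z) = theta2 τ z := by
  unfold theta2
  rw [← (Equiv.subLeft (-1 : ℤ)).tsum_eq]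
  refine tsum_congr fun n => ?_
  congr 1
  simp only [Equiv.subLeft_apply]
  push_cast
  ring

/-- The pairs of integers, split according to the parity of the sum of the coordinates and
parametrised by half the sum and half the difference. -/
noncomputable def intPairParityEquiv : (ℤ × ℤ) ⊕ (ℤ × ℤ) ≃ ℤ × ℤ :=
  Equiv.ofBijective
    (Sum.elim (fun p => (p.1 + p.2, p.1 - p.2 - 1)) fun p => (p.1 + p.2, p.1 - p.2)) <| by
    constructor
    · rintro (⟨a, b⟩ | ⟨a, b⟩) (⟨c, d⟩ | ⟨c, d⟩) h <;>
        simp only [Sum.elim_inl, Sum.elim_inr, Prod.mk.injEq, Sum.inl.injEq, Sum.inr.injEq,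
          reduceCtorEq] at h ⊢ <;> omega
    · rintro ⟨n, m⟩
      rcases Int.even_or_odd' (n + m) with ⟨k, hk | hk⟩
      · exact ⟨Sum.inr (k, n - k), by simp only [Sum.elim_inr, Prod.mk.injEq]; omega⟩
      · exact ⟨Sum.inl (k + 1, n - k - 1), by simp only [Sum.elim_inl, Prod.mk.injEq]; omega⟩

lemma intPairParityEquiv_inl (k l : ℤ) :
    intPairParityEquiv (Sum.inl (k, l)) = (k + l, k - l - 1) := rfl

lemma intPairParityEquiv_inr (k l : ℤ) :
    intPairParityEquiv (Sum.inr (k, l)) = (k + l, k - l) := rfl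

/-- The product formula expressing `θ₁ θ₁` at `τ` through theta functions at `2 τ`. -/
lemma theta1_mul_theta1 {τ : ℂ} (hτ : 0 < τ.im) (x y : ℂ) :
    theta1 τ x * theta1 τ y =
      jacobiTheta₂ (x + y) (2 * τ) * theta2 (2 * τ) (x - y) -
        theta2 (2 * τ) (x + y) * jacobiTheta₂ (x - y) (2 * τ) := by
  have h2τ : 0 < (2 * τ).im := by simpa using hτ
  have hA (z : ℂ) := (summable_jacobiTheta₂_term_iff z (2 * τ)).2 h2τ
  have hB (z : ℂ) := summable_theta2_term h2τ z
  have hC (z : ℂ) := summable_theta1_term hτ z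
  have hAB := summable_mul_of_summable_norm (hA (x + y)).norm (hB (x - y)).norm
  have hBA := summable_mul_of_summable_norm (hB (x + y)).norm (hA (x - y)).norm
  have hI (u v : ℂ) : -Complex.I * u * (-Complex.I * v) = -(u * v) := by
    linear_combination u * v * Complex.I_mul_I
  unfold theta1 theta2 jacobiTheta₂
  rw [hI, tsum_mul_tsum_of_summable_norm (hC x).norm (hC y).norm,
    tsum_mul_tsum_of_summable_norm (hA _).norm (hB _).norm,
    tsum_mul_tsum_of_summable_norm (hB _).norm (hA _).norm, sub_eq_add_neg, ← tsum_neg, ← tsum_neg]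
  refine HasSum.tsum_eq (intPairParityEquiv.hasSum_iff.1 (HasSum.sum ?_ ?_))
  · refine HasSum.congr_fun hAB.hasSum ?_
    rintro ⟨k, l⟩
    have hsign : (-1 : ℂ) ^ (k + l) * (-1 : ℂ) ^ (k - l - 1) = -1 := by
      rw [← zpow_add₀ (by norm_num), show k + l + (k - l - 1) = 2 * (k - 1) + 1 by ring]
      exact Odd.neg_one_zpow ⟨k - 1, rfl⟩
    simp only [Function.comp_apply, intPairParityEquiv_inl]
    rw [mul_mul_mul_comm, hsign, neg_one_mul, neg_neg, jacobiTheta₂_term, ← Complex.exp_add,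
      ← Complex.exp_add]
    congr 1
    push_cast
    ring
  · refine HasSum.congr_fun hBA.neg.hasSum ?_
    rintro ⟨k, l⟩
    have hsign : (-1 : ℂ) ^ (k + l) * (-1 : ℂ) ^ (k - l) = 1 := by
      rw [← zpow_add₀ (by norm_num), show k + l + (k - l) = 2 * k by ring]
      exact Even.neg_one_zpow ⟨k, by ring⟩
    simp only [Function.comp_apply, intPairParityEquiv_inr]
    rw [mul_mul_mul_comm, hsign, one_mul, jacobiTheta₂_term, ← Complex.exp_add,
      ← Complex.exp_add]
    congr 2
    push_cast
    ring

/-- The theta identity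
θ₁(ε₂)θ₁(λ+ε₂)θ₂(2τ,λ+2ε₁) − θ₁(ε₁)θ₁(λ+ε₁)θ₂(2τ,λ+2ε₂)
= θ₁(ε₂−ε₁)θ₁(λ+ε₁+ε₂)θ₂(2τ,λ). -/
theorem statement8 (τ : ℂ) (hτ : 0 < τ.im) (lam ε₁ ε₂ : ℂ) :
    theta1 τ ε₂ * theta1 τ (lam + ε₂) * theta2 (2 * τ) (lam + 2 * ε₁) -
      theta1 τ ε₁ * theta1 τ (lam + ε₁) * theta2 (2 * τ) (lam + 2 * ε₂) =
    theta1 τ (ε₂ - ε₁) * theta1 τ (lam + ε₁ + ε₂) * theta2 (2 * τ) lam := by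
  have h₁ := theta1_mul_theta1 hτ ε₂ (lam + ε₂)
  have h₂ := theta1_mul_theta1 hτ ε₁ (lam + ε₁)
  have h₃ := theta1_mul_theta1 hτ (ε₂ - ε₁) (lam + ε₁ + ε₂)
  rw [show ε₂ + (lam + ε₂) = lam + 2 * ε₂ by ring, show ε₂ - (lam + ε₂) = -lam by ring,
    theta2_neg, jacobiTheta₂_neg_left] at h₁
  rw [show ε₁ + (lam + ε₁) = lam + 2 * ε₁ by ring, show ε₁ - (lam + ε₁) = -lam by ring,
    theta2_neg, jacobiTheta₂_neg_left] at h₂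
  rw [show ε₂ - ε₁ + (lam + ε₁ + ε₂) = lam + 2 * ε₂ by ring,
    show ε₂ - ε₁ - (lam + ε₁ + ε₂) = -(lam + 2 * ε₁) by ring,
    theta2_neg, jacobiTheta₂_neg_left] at h₃
  rw [h₁, h₂, h₃]
  ring
end
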